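/- There exist constants C₀, C > 0 (independent of m, n, d) such that, if for each i ∈ [m] the matrix Ẑ^{(i)} ∈ ℝ^{(d−r)×r} satisfies the quadratic matrix equation 0 = −X̂ⁱ₂₁ + Ẑ^{(i)} X̂ⁱ₁₁ − X̂ⁱ₂₂ Ẑ^{(i)} + Ẑ^{(i)} X̂ⁱ₁₂ Ẑ^{(i)} and ‖Ẑ^{(i)}‖₂ ≤ C₀·min{1, ‖X̂ⁱ − X‖₂/δ}, then the matrices Ŷ^{(i)} := V₂ Ẑ^{(i)} satisfy ‖(1/m) Σ_{i=1}^m Ŷ^{(i)}‖₂ ≤ C·[ (1/(δ² m)) Σ_{i=1}^m ‖X̂ⁱ − X‖₂² + (1/δ)·‖(1/m) Σ_{i=1}^m X̂ⁱ − X‖₂ ]. -/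

import Mathlib

open Matrix

/-- Spectral norm (operator norm induced by the Euclidean norm) of a real matrix. -/
noncomputable def spec {α β : Type*} [Fintype α] [Fintype β] [DecidableEq β]
    (A : Matrix α β ℝ) : ℝ :=
  ‖LinearMap.toContinuousLinearMap (Matrix.toEuclideanLin A)‖

open scoped Matrix.Norms.L2Operator

theorem spec_eq_l2_opNorm {α β : Type*} [Fintype α] [Fintype β] [DecidableEq β]
    (A : Matrix α β ℝ) : spec A = ‖A‖ := rfl

theorem l2_opNorm_le_one_of_transpose_mul_self {α β : Type*} [Fintype α] [Fintype β]
    [DecidableEq α] [DecidableEq β] {V : Matrix α β ℝ} (hV : Vᵀ * V = 1) : ‖V‖ ≤ 1 := by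
  have h := Matrix.l2_opNorm_conjTranspose_mul_self V
  rw [Matrix.conjTranspose_eq_transpose_of_trivial, hV, ← Matrix.diagonal_one,
    Matrix.l2_opNorm_diagonal] at h
  have h1 : ‖(fun _ : β => (1 : ℝ))‖ ≤ 1 :=
    (pi_norm_le_iff_of_nonneg zero_le_one).2 fun _ => by simp
  nlinarith [norm_nonneg V]

theorem l2_opNorm_transpose {α β : Type*} [Fintype α] [Fintype β]
    [DecidableEq α] [DecidableEq β] (A : Matrix α β ℝ) : ‖Aᵀ‖ = ‖A‖ := by
  rw [← Matrix.conjTranspose_eq_transpose_of_trivial, Matrix.l2_opNorm_conjTranspose]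

/-- Compression by matrices with orthonormal columns does not increase the spectral norm. -/
theorem l2_opNorm_compression_le {α β γ : Type*} [Fintype α] [Fintype β] [Fintype γ]
    [DecidableEq α] [DecidableEq β] [DecidableEq γ] {U : Matrix α β ℝ} {V : Matrix α γ ℝ}
    (hU : Uᵀ * U = 1) (hV : Vᵀ * V = 1) (E : Matrix α α ℝ) : ‖Uᵀ * E * V‖ ≤ ‖E‖ := by
  have hU' : ‖Uᵀ‖ ≤ 1 := by
    rw [l2_opNorm_transpose]
    exact l2_opNorm_le_one_of_transpose_mul_self hU
  have hV' := l2_opNorm_le_one_of_transpose_mul_self hV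
  calc ‖Uᵀ * E * V‖ ≤ ‖Uᵀ‖ * ‖E‖ * ‖V‖ :=
        (Matrix.l2_opNorm_mul _ _).trans
          (mul_le_mul_of_nonneg_right (Matrix.l2_opNorm_mul _ _) (norm_nonneg _))
    _ ≤ 1 * ‖E‖ * 1 := by gcongr
    _ = ‖E‖ := by ring

/-- The Sylvester operator `Z ↦ Z Λ₁ - Λ₂ Z` is bounded below by the gap between the spectra
when the spectrum of `Λ₁` lies above that of `Λ₂`. -/
theorem l2_opNorm_le_of_sylvester {ι κ : Type*} [Fintype ι] [Fintype κ] [DecidableEq ι]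
    [DecidableEq κ] {lam : ι → ℝ} {mu : κ → ℝ} {b δ : ℝ} (hδ : 0 < δ)
    (hmu : ∀ j, mu j ≤ b) (hlam : ∀ i, b + δ ≤ lam i) (Z : Matrix κ ι ℝ) :
    δ * ‖Z‖ ≤ ‖Z * Matrix.diagonal lam - Matrix.diagonal mu * Z‖ := by
  set W := Z * Matrix.diagonal lam - Matrix.diagonal mu * Z with hW
  -- shift both spectra far enough to make `mu` nonnegative
  set c : ℝ := ∑ j, |mu j| + |b|
  have hcmu : ∀ j, 0 ≤ mu j + c := fun j => by
    have h1 := Finset.single_le_sum (f := fun j => |mu j|) (fun _ _ => abs_nonneg _)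
      (Finset.mem_univ j)
    linarith [neg_abs_le (mu j), abs_nonneg b]
  have hcb : 0 ≤ b + c := by
    have h1 : 0 ≤ ∑ j, |mu j| := Finset.sum_nonneg fun _ _ => abs_nonneg _
    linarith [neg_abs_le b]
  have hpos : 0 < b + δ + c := by linarith
  have hlamc : ∀ i, b + δ + c ≤ lam i + c := fun i => by linarith [hlam i]
  have hinv : ‖Matrix.diagonal fun i => (lam i + c)⁻¹‖ ≤ (b + δ + c)⁻¹ := by
    rw [Matrix.l2_opNorm_diagonal, pi_norm_le_iff_of_nonneg (inv_nonneg.2 hpos.le)]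
    intro i
    rw [Real.norm_of_nonneg (inv_nonneg.2 (hpos.le.trans (hlamc i)))]
    exact inv_anti₀ hpos (hlamc i)
  have hdiag : ‖Matrix.diagonal fun j => mu j + c‖ ≤ b + c := by
    rw [Matrix.l2_opNorm_diagonal, pi_norm_le_iff_of_nonneg hcb]
    intro j
    rw [Real.norm_of_nonneg (hcmu j)]
    linarith [hmu j]
  have hZ : Z = (W + Matrix.diagonal (fun j => mu j + c) * Z)
      * Matrix.diagonal fun i => (lam i + c)⁻¹ := by
    ext j i
    have : lam i + c ≠ 0 := (hpos.trans_le (hlamc i)).ne'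
    simp only [hW, Matrix.mul_diagonal, Matrix.diagonal_mul, Matrix.add_apply, Matrix.sub_apply]
    field_simp
    ring
  have hle : ‖Z‖ ≤ (‖W‖ + (b + c) * ‖Z‖) * (b + δ + c)⁻¹ := by
    calc ‖Z‖ = ‖(W + Matrix.diagonal (fun j => mu j + c) * Z)
          * Matrix.diagonal fun i => (lam i + c)⁻¹‖ := congrArg norm hZ
      _ ≤ ‖W + Matrix.diagonal (fun j => mu j + c) * Z‖
          * ‖Matrix.diagonal fun i => (lam i + c)⁻¹‖ := Matrix.l2_opNorm_mul _ _
      _ ≤ (‖W‖ + (b + c) * ‖Z‖) * (b + δ + c)⁻¹ := by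
        gcongr
        refine (norm_add_le _ _).trans ?_
        gcongr
        exact (Matrix.l2_opNorm_mul _ _).trans (by gcongr)
  rw [← div_eq_mul_inv, le_div_iff₀ hpos] at hle
  linarith

/-- The part of the quadratic matrix equation that is of second order in the perturbation. -/
theorem l2_opNorm_quadratic_remainder_le {ι κ : Type*} [Fintype ι] [Fintype κ] [DecidableEq ι]
    [DecidableEq κ] {Z : Matrix κ ι ℝ} {E₁₁ : Matrix ι ι ℝ} {E₁₂ : Matrix ι κ ℝ}
    {E₂₂ : Matrix κ κ ℝ} {e δ K : ℝ} (hδ : 0 < δ) (hK : 0 ≤ K) (h₁₁ : ‖E₁₁‖ ≤ e)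
    (h₁₂ : ‖E₁₂‖ ≤ e) (h₂₂ : ‖E₂₂‖ ≤ e) (hZ : ‖Z‖ ≤ K * min 1 (e / δ)) :
    ‖E₂₂ * Z - Z * E₁₁ - Z * E₁₂ * Z‖ ≤ (2 * K + K ^ 2) * (e ^ 2 / δ) := by
  have he : 0 ≤ e := (norm_nonneg _).trans h₁₁
  have hZK : ‖Z‖ ≤ K := hZ.trans (mul_le_of_le_one_right hK (min_le_left _ _))
  have hZe : ‖Z‖ ≤ K * (e / δ) := hZ.trans (mul_le_mul_of_nonneg_left (min_le_right _ _) hK)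
  have h1 : ‖E₂₂ * Z‖ ≤ e * (K * (e / δ)) :=
    (Matrix.l2_opNorm_mul _ _).trans (by gcongr)
  have h2 : ‖Z * E₁₁‖ ≤ K * (e / δ) * e :=
    (Matrix.l2_opNorm_mul _ _).trans (by gcongr)
  have h3 : ‖Z * E₁₂ * Z‖ ≤ K * (e / δ) * e * K :=
    calc ‖Z * E₁₂ * Z‖ ≤ ‖Z * E₁₂‖ * ‖Z‖ := Matrix.l2_opNorm_mul _ _
      _ ≤ ‖Z‖ * ‖E₁₂‖ * ‖Z‖ := by
        gcongr
        exact Matrix.l2_opNorm_mul _ _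
      _ ≤ K * (e / δ) * e * K := by gcongr
  calc ‖E₂₂ * Z - Z * E₁₁ - Z * E₁₂ * Z‖ ≤ ‖E₂₂ * Z‖ + ‖Z * E₁₁‖ + ‖Z * E₁₂ * Z‖ :=
        (norm_sub_le _ _).trans (by gcongr; exact norm_sub_le _ _)
    _ ≤ e * (K * (e / δ)) + K * (e / δ) * e + K * (e / δ) * e * K := by gcongr
    _ = (2 * K + K ^ 2) * (e ^ 2 / δ) := by ring

theorem statement2 :
    ∃ C₀ C : ℝ, 0 < C₀ ∧ 0 < C ∧
    ∀ (d r m : ℕ), r < d → 0 < m →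
    ∀ (X : Matrix (Fin d) (Fin d) ℝ) (V₁ : Matrix (Fin d) (Fin r) ℝ)
      (V₂ : Matrix (Fin d) (Fin (d - r)) ℝ) (lam : Fin r → ℝ) (mu : Fin (d - r) → ℝ)
      (δ : ℝ) (Xh : Fin m → Matrix (Fin d) (Fin d) ℝ)
      (Z : Fin m → Matrix (Fin (d - r)) (Fin r) ℝ),
      0 < δ →
      V₁ᵀ * V₁ = 1 → V₂ᵀ * V₂ = 1 → V₁ᵀ * V₂ = 0 → V₁ * V₁ᵀ + V₂ * V₂ᵀ = 1 →
      X = V₁ * Matrix.diagonal lam * V₁ᵀ + V₂ * Matrix.diagonal mu * V₂ᵀ →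
      (∀ i j, mu j + δ ≤ lam i) →
      (∀ i, (Xh i)ᵀ = Xh i) →
      (∀ i, spec (Xh i - X) < δ / 8) →
      (∀ i, 0 = -(V₂ᵀ * Xh i * V₁) + Z i * (V₁ᵀ * Xh i * V₁)
             - (V₂ᵀ * Xh i * V₂) * Z i + Z i * (V₁ᵀ * Xh i * V₂) * Z i) →
      (∀ i, spec (Z i) ≤ C₀ * min 1 (spec (Xh i - X) / δ)) →
      spec ((m : ℝ)⁻¹ • ∑ i, V₂ * Z i)
        ≤ C * ((δ ^ 2 * m)⁻¹ * ∑ i, spec (Xh i - X) ^ 2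
               + δ⁻¹ * spec (((m : ℝ)⁻¹ • ∑ i, Xh i) - X)) := by
  refine ⟨4, 24, by norm_num, by norm_num, ?_⟩
  intro d r m hrd hm X V₁ V₂ lam mu δ Xh Z hδ h11 h22 h12 _ hX hgap _ _ hZeq hZ
  simp only [spec_eq_l2_opNorm] at hZ ⊢
  have h21 : V₂ᵀ * V₁ = 0 := by
    rw [← Matrix.transpose_transpose (V₂ᵀ * V₁), Matrix.transpose_mul,
      Matrix.transpose_transpose, h12, Matrix.transpose_zero]
  have hXV₁ : X * V₁ = V₁ * Matrix.diagonal lam := by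
    rw [hX, Matrix.add_mul, Matrix.mul_assoc _ V₁ᵀ, Matrix.mul_assoc _ V₂ᵀ, h11, h21,
      Matrix.mul_one, Matrix.mul_zero, add_zero]
  have hXV₂ : X * V₂ = V₂ * Matrix.diagonal mu := by
    rw [hX, Matrix.add_mul, Matrix.mul_assoc _ V₁ᵀ, Matrix.mul_assoc _ V₂ᵀ, h12, h22,
      Matrix.mul_one, Matrix.mul_zero, zero_add]
  have hm' : (m : ℝ) ≠ 0 := by exact_mod_cast hm.ne'
  have : Nonempty (Fin (d - r)) := ⟨⟨0, by omega⟩⟩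
  obtain ⟨j₀, hj₀⟩ := Finite.exists_max mu
  set R : Fin m → Matrix (Fin (d - r)) (Fin r) ℝ := fun i =>
    (V₂ᵀ * (Xh i - X) * V₂) * Z i - Z i * (V₁ᵀ * (Xh i - X) * V₁)
      - Z i * (V₁ᵀ * (Xh i - X) * V₂) * Z i with hR
  have hsylv : ∀ i, Z i * Matrix.diagonal lam - Matrix.diagonal mu * Z i
      = V₂ᵀ * (Xh i - X) * V₁ + R i := fun i => by
    have e11 : V₁ᵀ * (Xh i - X) * V₁ = V₁ᵀ * Xh i * V₁ - Matrix.diagonal lam := by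
      rw [Matrix.mul_sub, Matrix.sub_mul, Matrix.mul_assoc _ X, hXV₁, ← Matrix.mul_assoc, h11,
        Matrix.one_mul]
    have e22 : V₂ᵀ * (Xh i - X) * V₂ = V₂ᵀ * Xh i * V₂ - Matrix.diagonal mu := by
      rw [Matrix.mul_sub, Matrix.sub_mul, Matrix.mul_assoc _ X, hXV₂, ← Matrix.mul_assoc, h22,
        Matrix.one_mul]
    have e12 : V₁ᵀ * (Xh i - X) * V₂ = V₁ᵀ * Xh i * V₂ := by
      rw [Matrix.mul_sub, Matrix.sub_mul, Matrix.mul_assoc _ X, hXV₂, ← Matrix.mul_assoc, h12,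
        Matrix.zero_mul, sub_zero]
    have e21 : V₂ᵀ * (Xh i - X) * V₁ = V₂ᵀ * Xh i * V₁ := by
      rw [Matrix.mul_sub, Matrix.sub_mul, Matrix.mul_assoc _ X, hXV₁, ← Matrix.mul_assoc, h21,
        Matrix.zero_mul, sub_zero]
    simp only [hR, e11, e22, e12, e21]
    rw [Matrix.mul_sub, Matrix.sub_mul]
    rw [← sub_eq_zero]
    refine Eq.trans ?_ (hZeq i).symm
    abel
  have hRle : ∀ i, ‖R i‖ ≤ 24 * (‖Xh i - X‖ ^ 2 / δ) := fun i =>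
    (l2_opNorm_quadratic_remainder_le hδ (by norm_num) (l2_opNorm_compression_le h11 h11 _)
      (l2_opNorm_compression_le h11 h22 _) (l2_opNorm_compression_le h22 h22 _) (hZ i)).trans
      (by norm_num)
  set Zbar := (m : ℝ)⁻¹ • ∑ i, Z i with hZbar
  have hmean : ((m : ℝ)⁻¹ • ∑ i, Xh i) - X = (m : ℝ)⁻¹ • ∑ i, (Xh i - X) := by
    rw [Finset.sum_sub_distrib, Finset.sum_const, Finset.card_univ, Fintype.card_fin, smul_sub,
      ← Nat.cast_smul_eq_nsmul ℝ, smul_smul, inv_mul_cancel₀ hm', one_smul]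
  have hbar : Zbar * Matrix.diagonal lam - Matrix.diagonal mu * Zbar
      = V₂ᵀ * (((m : ℝ)⁻¹ • ∑ i, Xh i) - X) * V₁ + (m : ℝ)⁻¹ • ∑ i, R i := by
    rw [hmean, hZbar, Matrix.smul_mul, Matrix.mul_smul, Matrix.mul_smul, Matrix.smul_mul,
      ← smul_sub, ← smul_add, Matrix.sum_mul, Matrix.mul_sum, Matrix.mul_sum, Matrix.sum_mul,
      ← Finset.sum_sub_distrib, ← Finset.sum_add_distrib]
    exact congrArg _ (Finset.sum_congr rfl fun i _ => hsylv i)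
  have hmain := l2_opNorm_le_of_sylvester hδ hj₀ (fun i => hgap i j₀) Zbar
  have hRbar : ‖(m : ℝ)⁻¹ • ∑ i, R i‖ ≤ (m : ℝ)⁻¹ * (24 / δ * ∑ i, ‖Xh i - X‖ ^ 2) := by
    rw [norm_smul, Real.norm_of_nonneg (by positivity), Finset.mul_sum]
    gcongr
    refine (norm_sum_le _ _).trans (Finset.sum_le_sum fun i _ => (hRle i).trans (le_of_eq ?_))
    ring
  have hZbound : δ * ‖Zbar‖ ≤ ‖((m : ℝ)⁻¹ • ∑ i, Xh i) - X‖
      + (m : ℝ)⁻¹ * (24 / δ * ∑ i, ‖Xh i - X‖ ^ 2) := by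
    rw [hbar] at hmain
    exact hmain.trans ((norm_add_le _ _).trans
      (add_le_add (l2_opNorm_compression_le h22 h11 _) hRbar))
  have hY : ‖(m : ℝ)⁻¹ • ∑ i, V₂ * Z i‖ ≤ ‖Zbar‖ := by
    rw [← Matrix.mul_sum, ← Matrix.mul_smul]
    exact (Matrix.l2_opNorm_mul _ _).trans (mul_le_of_le_one_left (norm_nonneg _)
      (l2_opNorm_le_one_of_transpose_mul_self h22))
  set e := ‖((m : ℝ)⁻¹ • ∑ i, Xh i) - X‖
  set S := ∑ i, ‖Xh i - X‖ ^ 2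
  calc _ ≤ ‖Zbar‖ := hY
    _ ≤ (e + (m : ℝ)⁻¹ * (24 / δ * S)) / δ := by
      rw [le_div_iff₀ hδ]
      linarith
    _ = 24 * ((δ ^ 2 * m)⁻¹ * S) + δ⁻¹ * e := by
      field_simp
      ring
    _ ≤ 24 * ((δ ^ 2 * m)⁻¹ * S + δ⁻¹ * e) := by
      have : 0 ≤ δ⁻¹ * e := by positivity
      linarith
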